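/- Let q = 2^h be a power of 2 and F a finite field with q elements. Let W₈ = { [[x, y, 0], [y, 0, z], [0, z, 0]] : x, y, z ∈ F } ⊆ Sym₃(F). Then the point-orbit distribution of W₈ is [1, q+1, q−1, q²−q]: W₈ has exactly one rank-1 point, exactly q+1 rank-2 points with zero diagonal, exactly q−1 rank-2 points with nonzero diagonal, and exactly q²−q rank-3 points. -/

import Mathlib

open Matrix

/-- A *point* of a plane `W` of `PG(5,q)` (viewed as a 3-dimensional linear subspace of the
space of symmetric `3×3` matrices): a 1-dimensional linear subspace `P ≤ W`, all of whose
nonzero matrices satisfy the predicate `pred` (e.g. a rank condition). -/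
def IsPointOf (F : Type) [Field F] (W P : Submodule F (Matrix (Fin 3) (Fin 3) F))
    (pred : Matrix (Fin 3) (Fin 3) F → Prop) : Prop :=
  P ≤ W ∧ Module.finrank F ↥P = 1 ∧ ∀ M ∈ P, M ≠ 0 → pred M

/-- The general element of the plane `W₈`. -/
def sigma8Matrix {F : Type} [Field F] (x y z : F) : Matrix (Fin 3) (Fin 3) F :=
  !![x, y, 0; y, 0, z; 0, z, 0]

theorem smul_sigma8Matrix {F : Type} [Field F] (c x y z : F) :
    c • sigma8Matrix x y z = sigma8Matrix (c * x) (c * y) (c * z) := by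
  simp [sigma8Matrix]

theorem sigma8Matrix_inj {F : Type} [Field F] {x y z x' y' z' : F} :
    sigma8Matrix x y z = sigma8Matrix x' y' z' ↔ x = x' ∧ y = y' ∧ z = z' := by
  refine ⟨fun H => ⟨?_, ?_, ?_⟩, by rintro ⟨rfl, rfl, rfl⟩; rfl⟩
  · simpa [sigma8Matrix] using congrFun (congrFun H 0) 0
  · simpa [sigma8Matrix] using congrFun (congrFun H 0) 1
  · simpa [sigma8Matrix] using congrFun (congrFun H 1) 2

theorem sigma8Matrix_eq_zero {F : Type} [Field F] {x y z : F} :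
    sigma8Matrix x y z = 0 ↔ x = 0 ∧ y = 0 ∧ z = 0 := by
  have H : (0 : Matrix (Fin 3) (Fin 3) F) = sigma8Matrix 0 0 0 := by
    rw [← zero_smul F (sigma8Matrix 0 0 0), smul_sigma8Matrix]; simp
  rw [H, sigma8Matrix_inj]

theorem rank_sigma8Matrix_eq_three {F : Type} [Field F] {x y z : F} (hx : x ≠ 0) (hz : z ≠ 0) :
    (sigma8Matrix x y z).rank = 3 := by
  have hd : (sigma8Matrix x y z).det ≠ 0 := by
    simp [sigma8Matrix, Matrix.det_fin_three, hx, hz]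
  simpa using Matrix.rank_of_det_ne_zero hd

theorem rank_sigma8Matrix_le_two {F : Type} [Field F] {x y z : F} (h : x = 0 ∨ z = 0) :
    (sigma8Matrix x y z).rank ≤ 2 := by
  obtain ⟨A, B, hAB⟩ : ∃ (A : Matrix (Fin 3) (Fin 2) F) (B : Matrix (Fin 2) (Fin 3) F),
      sigma8Matrix x y z = A * B := by
    rcases h with rfl | rfl
    · refine ⟨!![y, 0; 0, 1; z, 0], !![0, 1, 0; y, 0, z], ?_⟩
      ext i j
      fin_cases i <;> fin_cases j <;> simp [sigma8Matrix, Matrix.mul_apply]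
    · refine ⟨!![x, y; y, 0; 0, 0], !![1, 0, 0; 0, 1, 0], ?_⟩
      ext i j
      fin_cases i <;> fin_cases j <;> simp [sigma8Matrix, Matrix.mul_apply]
  rw [hAB]
  exact (Matrix.rank_mul_le_left A B).trans (Matrix.rank_le_width A)

theorem two_le_rank_sigma8Matrix {F : Type} [Field F] {x y z : F} (h : y ≠ 0 ∨ z ≠ 0) :
    2 ≤ (sigma8Matrix x y z).rank := by
  obtain ⟨f, hf⟩ : ∃ f : Fin 2 → Fin 3, ((sigma8Matrix x y z).submatrix f f).det ≠ 0 := by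
    rcases h with h | h
    · exact ⟨![0, 1], by rw [Matrix.det_fin_two]; simp [sigma8Matrix, h]⟩
    · exact ⟨![1, 2], by rw [Matrix.det_fin_two]; simp [sigma8Matrix, h]⟩
  simpa [Matrix.rank_of_det_ne_zero hf] using Matrix.rank_submatrix_le (sigma8Matrix x y z) f f

theorem rank_sigma8Matrix_eq_one {F : Type} [Field F] {x : F} (hx : x ≠ 0) :
    (sigma8Matrix x 0 0).rank = 1 := by
  have hv : sigma8Matrix x 0 0 = Matrix.vecMulVec ![x, 0, 0] ![1, 0, 0] := by
    ext i j
    fin_cases i <;> fin_cases j <;> simp [sigma8Matrix, Matrix.vecMulVec_apply]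
  have hle : (sigma8Matrix x 0 0).rank ≤ 1 := hv ▸ Matrix.rank_vecMulVec_le _ _
  have hd : ((sigma8Matrix x 0 0).submatrix ![(0 : Fin 3)] ![(0 : Fin 3)]).det ≠ 0 := by
    rw [Matrix.det_fin_one]; simpa [sigma8Matrix] using hx
  have hge := Matrix.rank_submatrix_le (sigma8Matrix x 0 0) ![(0 : Fin 3)] ![(0 : Fin 3)]
  rw [Matrix.rank_of_det_ne_zero hd] at hge
  simp at hge
  omega

theorem rank_sigma8Matrix_eq_three_iff {F : Type} [Field F] {x y z : F} :
    (sigma8Matrix x y z).rank = 3 ↔ x ≠ 0 ∧ z ≠ 0 := by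
  refine ⟨fun H => ?_, fun H => rank_sigma8Matrix_eq_three H.1 H.2⟩
  by_contra hc
  have := rank_sigma8Matrix_le_two (x := x) (y := y) (z := z) (by tauto)
  omega

theorem rank_sigma8Matrix_eq_two_iff {F : Type} [Field F] {x y z : F} :
    (sigma8Matrix x y z).rank = 2 ↔ (x = 0 ∨ z = 0) ∧ (y ≠ 0 ∨ z ≠ 0) := by
  refine ⟨fun H => ⟨?_, ?_⟩, fun H =>
    le_antisymm (rank_sigma8Matrix_le_two H.1) (two_le_rank_sigma8Matrix H.2)⟩
  · by_contra hc
    have := rank_sigma8Matrix_eq_three (x := x) (y := y) (z := z) (by tauto) (by tauto)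
    omega
  · by_contra! hc
    obtain ⟨rfl, rfl⟩ := hc
    by_cases hx : x = 0
    · rw [sigma8Matrix_eq_zero.2 ⟨hx, rfl, rfl⟩, Matrix.rank_zero] at H
      omega
    · have := rank_sigma8Matrix_eq_one hx
      omega

theorem rank_sigma8Matrix_eq_one_iff {F : Type} [Field F] {x y z : F} :
    (sigma8Matrix x y z).rank = 1 ↔ x ≠ 0 ∧ y = 0 ∧ z = 0 := by
  refine ⟨fun H => ?_, by rintro ⟨hx, rfl, rfl⟩; exact rank_sigma8Matrix_eq_one hx⟩
  have hyz : y = 0 ∧ z = 0 := by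
    by_contra hc
    have := two_le_rank_sigma8Matrix (x := x) (y := y) (z := z) (by tauto)
    omega
  refine ⟨?_, hyz⟩
  rintro rfl
  rw [sigma8Matrix_eq_zero.2 ⟨rfl, hyz⟩, Matrix.rank_zero] at H
  omega

theorem sigma8Matrix_diag_eq_zero_iff {F : Type} [Field F] {x y z : F} :
    (∀ i, sigma8Matrix x y z i i = 0) ↔ x = 0 := by
  simp [sigma8Matrix, Fin.forall_fin_succ]

theorem sigma8Matrix_exists_diag_ne_zero_iff {F : Type} [Field F] {x y z : F} :
    (∃ i, sigma8Matrix x y z i i ≠ 0) ↔ x ≠ 0 := by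
  rw [← not_iff_not, not_not, ← sigma8Matrix_diag_eq_zero_iff (y := y) (z := z)]
  push Not
  rfl

/-- The points of `W` satisfying `pred` are counted by a system of representatives. -/
theorem card_isPointOf_eq {F α : Type} [Field F] {W : Submodule F (Matrix (Fin 3) (Fin 3) F)}
    {pred : Matrix (Fin 3) (Fin 3) F → Prop} (f : α → Matrix (Fin 3) (Fin 3) F)
    (hW : ∀ a, f a ∈ W) (h0 : ∀ a, f a ≠ 0) (hpred : ∀ a, ∀ c : F, c ≠ 0 → pred (c • f a))
    (hsurj : ∀ M ∈ W, M ≠ 0 → pred M → ∃ a, ∃ c : F, c • f a = M)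
    (hinj : ∀ a b, ∀ c : F, c • f a = f b → a = b) :
    Nat.card {P | IsPointOf F W P pred} = Nat.card α := by
  symm
  refine Nat.card_congr (Equiv.ofBijective
    (fun a => ⟨Submodule.span F {f a}, ?_, finrank_span_singleton (h0 a), ?_⟩) ⟨?_, ?_⟩)
  · simpa using hW a
  · intro M hM hM0
    obtain ⟨c, rfl⟩ := Submodule.mem_span_singleton.1 hM
    exact hpred a c (by rintro rfl; simp at hM0)
  · intro a b hab
    have hab' : Submodule.span F {f a} = Submodule.span F {f b} := congrArg Subtype.val hab
    obtain ⟨c, hc⟩ := Submodule.mem_span_singleton.1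
      (hab' ▸ Submodule.mem_span_singleton_self (f b) : f b ∈ Submodule.span F {f a})
    exact hinj a b c hc
  · rintro ⟨P, hPW, hP1, hP⟩
    obtain ⟨M, hMP, hM0⟩ := P.exists_mem_ne_zero_of_ne_bot (by rintro rfl; simp at hP1)
    obtain ⟨a, c, rfl⟩ := hsurj M (hPW hMP) hM0 (hP M hMP hM0)
    have hc : c ≠ 0 := by rintro rfl; simp at hM0
    have ha : f a ∈ P := (P.smul_mem_iff hc).1 hMP
    have : Module.Finite F P := Module.finite_of_finrank_eq_succ hP1
    refine ⟨a, Subtype.ext (Submodule.eq_of_le_of_finrank_eq ?_ ?_)⟩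
    · simpa using ha
    · rw [hP1]; exact finrank_span_singleton (h0 a)

theorem sigma8_point_orbit_distribution (h : ℕ) (hh : 0 < h)
    (F : Type) [Field F] [Fintype F] (hF : Fintype.card F = 2 ^ h)
    (W : Submodule F (Matrix (Fin 3) (Fin 3) F))
    (hW : (W : Set (Matrix (Fin 3) (Fin 3) F)) =
      {M | ∃ x y z : F, M = !![x, y, 0; y, 0, z; 0, z, 0]}) :
    Nat.card {P | IsPointOf F W P (fun M => M.rank = 1)} = 1 ∧
    Nat.card {P | IsPointOf F W P (fun M => M.rank = 2 ∧ ∀ i, M i i = 0)} = 2 ^ h + 1 ∧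
    Nat.card {P | IsPointOf F W P (fun M => M.rank = 2 ∧ ∃ i, M i i ≠ 0)} = 2 ^ h - 1 ∧
    Nat.card {P | IsPointOf F W P (fun M => M.rank = 3)} = (2 ^ h) ^ 2 - 2 ^ h := by
  have hmem : ∀ M, M ∈ W ↔ ∃ x y z : F, M = sigma8Matrix x y z := fun M => by
    rw [← SetLike.mem_coe, hW]; rfl
  have hmk : ∀ x y z : F, sigma8Matrix x y z ∈ W := fun x y z => (hmem _).2 ⟨x, y, z, rfl⟩
  have hq : Nat.card F = 2 ^ h := by rw [Nat.card_eq_fintype_card, hF]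
  refine ⟨?_, ?_, ?_, ?_⟩
  · rw [card_isPointOf_eq (fun _ : Unit => sigma8Matrix (1 : F) 0 0) (fun _ => hmk _ _ _)]
    · simp
    · simp [sigma8Matrix_eq_zero]
    · simp [smul_sigma8Matrix, rank_sigma8Matrix_eq_one_iff]
    · intro M hM _ hp
      obtain ⟨x, y, z, rfl⟩ := (hmem M).1 hM
      obtain ⟨-, rfl, rfl⟩ := rank_sigma8Matrix_eq_one_iff.1 hp
      exact ⟨(), x, by simp [smul_sigma8Matrix]⟩
    · simp
  · rw [card_isPointOf_eq (fun o : Option F => o.elim (sigma8Matrix 0 0 1) (sigma8Matrix 0 1))]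
    · rw [Finite.card_option, hq]
    · rintro (_ | a) <;> exact hmk _ _ _
    · rintro (_ | a) <;> simp [sigma8Matrix_eq_zero]
    · rintro (_ | a) c hc <;>
        simp [smul_sigma8Matrix, rank_sigma8Matrix_eq_two_iff, sigma8Matrix_diag_eq_zero_iff, hc]
    · rintro M hM - ⟨hp, hd⟩
      obtain ⟨x, y, z, rfl⟩ := (hmem M).1 hM
      obtain rfl := sigma8Matrix_diag_eq_zero_iff.1 hd
      by_cases hy : y = 0
      · exact ⟨none, z, by simp [smul_sigma8Matrix, hy]⟩
      · exact ⟨some (z / y), y, by simp [smul_sigma8Matrix, mul_div_cancel₀ _ hy]⟩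
    · rintro (_ | a) (_ | b) c hc <;>
        simp [smul_sigma8Matrix, sigma8Matrix_inj] at hc ⊢
      · simp [hc.1] at hc
      · simpa [hc.1] using hc.2
  · rw [card_isPointOf_eq (fun u : Fˣ => sigma8Matrix (1 : F) u 0) (fun _ => hmk _ _ _)]
    · rw [Nat.card_units, hq]
    · simp [sigma8Matrix_eq_zero]
    · intro u c hc
      simp [smul_sigma8Matrix, rank_sigma8Matrix_eq_two_iff,
        sigma8Matrix_exists_diag_ne_zero_iff, hc]
    · rintro M hM - ⟨hp, hd⟩
      obtain ⟨x, y, z, rfl⟩ := (hmem M).1 hM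
      have hx := sigma8Matrix_exists_diag_ne_zero_iff.1 hd
      have hp := rank_sigma8Matrix_eq_two_iff.1 hp
      have hz : z = 0 := by tauto
      have hy : y ≠ 0 := by tauto
      exact ⟨Units.mk0 (y / x) (div_ne_zero hy hx), x, by
        simp [smul_sigma8Matrix, hz, mul_div_cancel₀ _ hx]⟩
    · intro u v c hc
      simp only [smul_sigma8Matrix, sigma8Matrix_inj, mul_one] at hc
      exact Units.ext (by simpa [hc.1] using hc.2.1)
  · rw [card_isPointOf_eq (fun p : F × Fˣ => sigma8Matrix (1 : F) p.1 p.2) (fun _ => hmk _ _ _)]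
    · rw [Nat.card_prod, Nat.card_units, hq, Nat.mul_sub, mul_one, sq]
    · simp [sigma8Matrix_eq_zero]
    · intro p c hc
      simp [smul_sigma8Matrix, rank_sigma8Matrix_eq_three_iff, hc]
    · intro M hM _ hp
      obtain ⟨x, y, z, rfl⟩ := (hmem M).1 hM
      obtain ⟨hx, hz⟩ := rank_sigma8Matrix_eq_three_iff.1 hp
      exact ⟨(y / x, Units.mk0 (z / x) (div_ne_zero hz hx)), x, by
        simp [smul_sigma8Matrix, mul_div_cancel₀ _ hx]⟩
    · intro p r c hc
      simp only [smul_sigma8Matrix, sigma8Matrix_inj, mul_one] at hc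
      obtain ⟨rfl, h1, h2⟩ := hc
      exact Prod.ext (by simpa using h1) (Units.ext (by simpa using h2))
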